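/- There is no projective plane of order 6: there do not exist a point type P and line type L with an incidence (membership) relation forming a projective plane (any two distinct points on a unique line, any two distinct lines meeting in a unique point, and containing a quadrangle) whose order is 6, i.e., in which some (equivalently, every) line contains exactly 7 points. -/

import Mathlib

open Configuration

section Fin6
variable {P L : Type} [Membership P L] [ProjectivePlane P L]

/-- Two lines never cover the plane. -/
theorem pp6_exists_off (l k : L) : ∃ r : P, r ∉ l ∧ r ∉ k := by
  by_contra hcon
  push Not at hcon
  obtain ⟨p1, p2, p3, l1, l2, l3, h12, h13, h21, h22, h23, h31, h32, h33⟩ :=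
    @ProjectivePlane.exists_config P L _ _
  have key : ∀ k : L, (∀ r : P, r ∈ l2 ∨ r ∈ k) → False := by
    intro k hk
    have hE : ∀ {a b : P} {m n : L}, a ∈ m → b ∈ m → a ∈ n → b ∈ n → a = b ∨ m = n :=
      fun h1 h2 h3 h4 => Nondegenerate.eq_or_eq h1 h2 h3 h4
    have hp1 : p1 ∈ k := (hk p1).resolve_left h12
    have step : ∀ t : P, t ∈ l2 → t ∉ l3 → t ∈ k := by
      intro t ht ht3
      have hne : p1 ≠ t := by rintro rfl; exact h12 ht
      obtain ⟨n, ⟨hn1, hn2⟩, -⟩ := HasLines.existsUnique_line P L p1 t hne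
      have hnl : n ≠ l3 := by rintro rfl; exact h13 hn1
      obtain ⟨s, ⟨hs1, hs2⟩, -⟩ := HasPoints.existsUnique_point P L n l3 hnl
      rcases hk s with hs | hs
      · rcases hE hs1 hn2 hs ht with h | h
        · subst h; exact absurd hs2 ht3
        · subst h; exact absurd hn1 h12
      · rcases hE hs1 hn1 hs hp1 with h | h
        · subst h; exact absurd hs2 h13
        · subst h; exact hn2
    have h12' : l1 ≠ l2 := by rintro rfl; exact h31 h32
    obtain ⟨t, ⟨ht1, ht2⟩, -⟩ := HasPoints.existsUnique_point P L l1 l2 h12'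
    have ht3 : t ∉ l3 := by
      intro h
      rcases hE h h23 ht2 h22 with h | h
      · subst h; exact h21 ht1
      · subst h; exact h33 h32
    rcases hE (step t ht2 ht3) (step p3 h32 h33) ht2 h32 with h | h
    · subst h; exact h31 ht1
    · subst h; exact h12 hp1
  -- one of the lines is `l2`
  have hE : ∀ {a b : P} {m n : L}, a ∈ m → b ∈ m → a ∈ n → b ∈ n → a = b ∨ m = n :=
    fun h1 h2 h3 h4 => Nondegenerate.eq_or_eq h1 h2 h3 h4
  have h12' : l1 ≠ l2 := by rintro rfl; exact h31 h32
  obtain ⟨t, ⟨ht1, ht2⟩, -⟩ := HasPoints.existsUnique_point P L l1 l2 h12'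
  have ht_2 : t ≠ p2 := by rintro rfl; exact h21 ht1
  have ht_3 : t ≠ p3 := by rintro rfl; exact h31 ht1
  have h23' : p2 ≠ p3 := by rintro rfl; exact h33 h23
  have hl : l2 = l ∨ l2 = k := by
    have a := hcon t
    have b := hcon p2
    have c := hcon p3
    by_contra hh
    push Not at hh
    have e1 : ∀ n : L, l2 ≠ n → ∀ x y : P, x ∈ l2 → y ∈ l2 → x ≠ y → x ∈ n → y ∉ n := by
      intro n hn x y hx hy hxy hxn hyn
      rcases hE hx hy hxn hyn with h | h
      · exact hxy h
      · exact hn h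
    have := e1 l hh.1 t p2 ht2 h22 ht_2
    have := e1 l hh.1 t p3 ht2 h32 ht_3
    have := e1 l hh.1 p2 p3 h22 h32 h23'
    have := e1 k hh.2 t p2 ht2 h22 ht_2
    have := e1 k hh.2 t p3 ht2 h32 ht_3
    have := e1 k hh.2 p2 p3 h22 h32 h23'
    tauto
  rcases hl with rfl | rfl
  · exact key k fun r => or_iff_not_imp_left.2 (hcon r)
  · exact key l fun r => (or_iff_not_imp_left.2 (hcon r)).symm

theorem pp6_lines_finite (q : P) (m : L) (hq : q ∉ m) [Finite {p : P // p ∈ m}] :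
    Finite {n : L // q ∈ n} := by
  have hne : ∀ n : {n : L // q ∈ n}, n.1 ≠ m := by
    rintro ⟨n, hn⟩ rfl; exact hq hn
  have hex : ∀ n : {n : L // q ∈ n}, ∃ p : {p : P // p ∈ m}, p.1 ∈ n.1 := by
    intro n
    obtain ⟨s, ⟨h1, h2⟩, -⟩ := HasPoints.existsUnique_point P L n.1 m (hne n)
    exact ⟨⟨s, h2⟩, h1⟩
  choose f hf using hex
  refine Finite.of_injective f ?_
  intro a b hab
  have h1 := hf a
  have h2 := hf b
  rw [← hab] at h2
  rcases Nondegenerate.eq_or_eq a.2 h1 b.2 h2 with h | h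
  · exact absurd (h ▸ (f a).2) hq
  · exact Subtype.ext h

theorem pp6_points_finite (q : P) (m : L) (hq : q ∉ m) [Finite {n : L // q ∈ n}] :
    Finite {p : P // p ∈ m} := by
  have hex : ∀ p : {p : P // p ∈ m}, ∃ n : {n : L // q ∈ n}, p.1 ∈ n.1 := by
    intro p
    have hne : p.1 ≠ q := by
      intro h; exact hq (h ▸ p.2)
    obtain ⟨s, ⟨h1, h2⟩, -⟩ := HasLines.existsUnique_line P L p.1 q hne
    exact ⟨⟨s, h2⟩, h1⟩
  choose f hf using hex
  refine Finite.of_injective f ?_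
  intro a b hab
  have h1 := hf a
  have h2 := hf b
  rw [← hab] at h2
  rcases Nondegenerate.eq_or_eq h1 h2 a.2 b.2 with h | h
  · exact Subtype.ext h
  · exact absurd (h ▸ (f a).2) hq

theorem pp6_finite (l : L) [Finite {p : P // p ∈ l}] : Finite P ∧ Finite L := by
  have hline : ∀ m : L, Finite {p : P // p ∈ m} := by
    intro m
    obtain ⟨r, h1, h2⟩ := pp6_exists_off (P := P) l m
    have := pp6_lines_finite r l h1
    exact pp6_points_finite r m h2
  have hpt : ∀ q : P, Finite {n : L // q ∈ n} := by
    intro q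
    obtain ⟨m, hm⟩ := Nondegenerate.exists_line (L := L) q
    have := hline m
    exact pp6_lines_finite q m hm
  constructor
  · obtain ⟨q, hq⟩ := Nondegenerate.exists_point (P := P) l
    have : ∀ p : P, ∃ n : L, q ∈ n ∧ p ∈ n := by
      intro p
      by_cases h : p = q
      · subst h
        obtain ⟨r, hr, -⟩ : ∃ r : P, r ≠ p ∧ True := by
          obtain ⟨p1, p2, p3, l1, l2, l3, h12, h13, h21, h22, h23, h31, h32, h33⟩ :=
            @ProjectivePlane.exists_config P L _ _
          by_cases h : p2 = p
          · exact ⟨p3, fun h' => h33 (by rw [h', ← h]; exact h23), trivial⟩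
          · exact ⟨p2, h, trivial⟩
        obtain ⟨s, ⟨h1, h2⟩, -⟩ := HasLines.existsUnique_line P L r p hr
        exact ⟨s, h2, h2⟩
      · obtain ⟨s, ⟨h1, h2⟩, -⟩ := HasLines.existsUnique_line P L p q h
        exact ⟨s, h2, h1⟩
    choose f hf1 hf2 using this
    have := hpt q
    refine Finite.of_injective
      (fun p => (⟨⟨f p, hf1 p⟩, ⟨p, hf2 p⟩⟩ : Σ n : {n : L // q ∈ n}, {p : P // p ∈ n.1})) ?_
    intro a b hab
    exact congrArg (fun z : Σ n : {n : L // q ∈ n}, {p : P // p ∈ n.1} => z.2.1) hab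
  · have hex : ∀ n : {n : L // n ≠ l}, ∃ p : {p : P // p ∈ l}, p.1 ∈ n.1 := by
      intro n
      obtain ⟨s, ⟨h1, h2⟩, -⟩ := HasPoints.existsUnique_point P L n.1 l n.2
      exact ⟨⟨s, h2⟩, h1⟩
    choose f hf using hex
    have : Finite {n : L // n ≠ l} := by
      refine Finite.of_injective
        (fun n => (⟨f n, ⟨n.1, hf n⟩⟩ : Σ p : {p : P // p ∈ l}, {n : L // p.1 ∈ n})) ?_
      intro a b hab
      exact Subtype.ext
        (congrArg (fun z : Σ p : {p : P // p ∈ l}, {n : L // p.1 ∈ n} => z.2.1) hab)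
    have h2 : ({l}ᶜ : Set L).Finite := this
    exact Set.finite_univ_iff.1 (by
      rw [← Set.union_compl_self {l}]
      exact (Set.finite_singleton l).union h2)

open Classical in
/-- The fundamental quadratic identity of a finite projective plane. -/
theorem pp6_identity [Fintype P] [Fintype L] (n : ℕ) (hn : ∀ p : P, lineCount L p = n + 1)
    (x : P → ℚ) :
    ∑ l : L, (∑ p : P, if p ∈ l then x p else 0) ^ 2 = n * ∑ p, x p ^ 2 + (∑ p, x p) ^ 2 := by
  have h1 : ∀ p q : P, (∑ l : L, if p ∈ l ∧ q ∈ l then (1 : ℚ) else 0)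
      = 1 + if p = q then (n : ℚ) else 0 := by
    intro p q
    rw [Finset.sum_boole]
    by_cases h : p = q
    · subst h
      have := hn p
      rw [lineCount, Nat.card_eq_fintype_card, Fintype.card_subtype] at this
      simp only [and_self, this, if_true]
      push_cast; ring
    · obtain ⟨s, hs, hu⟩ := HasLines.existsUnique_line P L p q h
      have : Finset.univ.filter (fun l : L => p ∈ l ∧ q ∈ l) = {s} := by
        ext l
        simp only [Finset.mem_filter, Finset.mem_univ, true_and, Finset.mem_singleton]
        exact ⟨fun h => hu l h, fun h => h ▸ hs⟩
      rw [this]; simp [h]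
  calc _ = ∑ l : L, ∑ p : P, ∑ q : P, x p * x q * (if p ∈ l ∧ q ∈ l then (1 : ℚ) else 0) := by
        refine Finset.sum_congr rfl fun l _ => ?_
        rw [sq, Finset.sum_mul_sum]
        refine Finset.sum_congr rfl fun p _ => Finset.sum_congr rfl fun q _ => ?_
        by_cases h : p ∈ l <;> by_cases h' : q ∈ l <;> simp [h, h']
    _ = ∑ p : P, ∑ q : P, x p * x q * (1 + if p = q then (n : ℚ) else 0) := by
        rw [Finset.sum_comm]
        refine Finset.sum_congr rfl fun p _ => ?_
        rw [Finset.sum_comm]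
        refine Finset.sum_congr rfl fun q _ => ?_
        rw [← Finset.mul_sum, h1]
    _ = _ := by
        simp only [mul_add, Finset.sum_add_distrib, mul_ite, mul_zero, Finset.sum_ite_eq,
          Finset.mem_univ, if_true, mul_one]
        rw [sq (∑ p, x p), Finset.sum_mul_sum, add_comm, Finset.mul_sum]
        congr 1
        exact Finset.sum_congr rfl fun p _ => by ring

end Fin6

/-- Sign choice lemma. -/
theorem pp6_signs {V I : Type} [AddCommGroup V] [Module ℚ V] [FiniteDimensional ℚ V]
    [DecidableEq I]
    (f g : I → V →ₗ[ℚ] ℚ) (hg : ∀ v, (∀ i, g i v = 0) → v = 0) (s : Finset I) :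
    ∃ W : Submodule ℚ V, Module.finrank ℚ V ≤ Module.finrank ℚ W + s.card ∧
      (∀ v ∈ W, ∀ i ∈ s, f i v ^ 2 = g i v ^ 2) ∧
      (∀ v ∈ W, (∀ i, i ∉ s → g i v = 0) → v = 0) := by
  induction s using Finset.induction_on with
  | empty => exact ⟨⊤, by simp, by simp, fun v _ h => hg v fun i => h i (by simp)⟩
  | insert a s ha ih =>
    obtain ⟨W, hd, hsq, hk⟩ := ih
    have hdim : ∀ φ : V →ₗ[ℚ] ℚ, Module.finrank ℚ V ≤
        Module.finrank ℚ (W ⊓ LinearMap.ker φ : Submodule ℚ V) + (insert a s).card := by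
      intro φ
      rw [Finset.card_insert_of_notMem ha]
      have h1 := Submodule.finrank_sup_add_finrank_inf_eq W (LinearMap.ker φ)
      have h2 := LinearMap.finrank_range_add_finrank_ker φ
      have h3 := Submodule.finrank_le (W ⊔ LinearMap.ker φ)
      have h4 := Submodule.finrank_le (LinearMap.range φ)
      rw [Module.finrank_self] at h4
      omega
    have hcase : ∀ ε : ℚ, ε ^ 2 = 1 →
        (∀ v ∈ W, (∀ i, i ∉ insert a s → g i v = 0) → f a v = ε * g a v → v = 0) →
        ∃ W : Submodule ℚ V, Module.finrank ℚ V ≤ Module.finrank ℚ W + (insert a s).card ∧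
        (∀ v ∈ W, ∀ i ∈ insert a s, f i v ^ 2 = g i v ^ 2) ∧
        (∀ v ∈ W, (∀ i, i ∉ insert a s → g i v = 0) → v = 0) := by
      intro ε hε h
      have hmem : ∀ v ∈ W ⊓ LinearMap.ker (f a - ε • g a), f a v = ε * g a v := by
        intro v hv
        have := hv.2
        simp only [LinearMap.mem_ker, SetLike.mem_coe, LinearMap.sub_apply, LinearMap.smul_apply, smul_eq_mul] at this
        linarith
      refine ⟨W ⊓ LinearMap.ker (f a - ε • g a), hdim _, ?_, ?_⟩
      · intro v hv i hi
        rcases Finset.mem_insert.1 hi with rfl | hi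
        · rw [hmem v hv, mul_pow, hε, one_mul]
        · exact hsq v hv.1 i hi
      · intro v hv hz
        exact h v hv.1 hz (hmem v hv)
    by_cases h1 : ∀ v ∈ W, (∀ i, i ∉ insert a s → g i v = 0) → f a v = 1 * g a v → v = 0
    · exact hcase 1 (by norm_num) h1
    · refine hcase (-1) (by norm_num) ?_
      push Not at h1
      obtain ⟨u, hu, huz, huf, hu0⟩ := h1
      intro v hv hvz hvf
      have hgu : g a u ≠ 0 := by
        intro h0
        refine hu0 (hk u hu fun i hi => ?_)
        by_cases hia : i = a
        · rw [hia, h0]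
        · exact huz i (by simp [hia, hi])
      have hz : g a u • v - g a v • u = 0 := by
        refine hk _ (W.sub_mem (W.smul_mem _ hv) (W.smul_mem _ hu)) fun i hi => ?_
        by_cases hia : i = a
        · subst hia; simp; ring
        · have hi' : i ∉ insert a s := by simp [hia, hi]
          simp [huz i hi', hvz i hi']
      have hf := congrArg (f a) hz
      simp only [map_sub, map_smul, smul_eq_mul, map_zero, hvf, huf] at hf
      have hgv : g a v = 0 := by
        have : g a u * g a v = 0 := by linarith
        exact (mul_eq_zero.1 this).resolve_left hgu
      rw [hgv, zero_smul, sub_zero] at hz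
      exact (smul_eq_zero.1 hz).resolve_left hgu

/-- `a² + b² = 6 c²` has only the trivial integer solution. -/
theorem pp6_int (N : ℕ) : ∀ a b c : ℤ, c.natAbs ≤ N → a ^ 2 + b ^ 2 = 6 * c ^ 2 → c = 0 := by
  induction N with
  | zero => intro a b c h _; omega
  | succ N ih =>
    intro a b c hc h
    have hab : (3 : ℤ) ∣ a ∧ (3 : ℤ) ∣ b := by
      have h3 : (a ^ 2 + b ^ 2) % 3 = 0 := by rw [h]; omega
      have ha : a % 3 = 0 ∨ a % 3 = 1 ∨ a % 3 = 2 := by omega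
      have hb : b % 3 = 0 ∨ b % 3 = 1 ∨ b % 3 = 2 := by omega
      rcases ha with ha | ha | ha <;> rcases hb with hb | hb | hb <;>
        simp [pow_two, Int.add_emod, Int.mul_emod, ha, hb] at h3 ⊢ <;> omega
    obtain ⟨⟨a', rfl⟩, ⟨b', rfl⟩⟩ := hab
    have h3c : (3 : ℤ) ∣ c := by
      have : (3 : ℤ) ∣ c ^ 2 := by
        have h' : 3 * (a' ^ 2 + b' ^ 2) = 2 * c ^ 2 := by linarith
        omega
      exact Int.prime_three.dvd_of_dvd_pow this
    obtain ⟨c', rfl⟩ := h3c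
    by_cases h0 : c' = 0
    · simp [h0]
    · have := ih a' b' c' (by omega) (by linarith)
      exact absurd this h0

theorem pp6_rat (a b c : ℚ) (h : a ^ 2 + b ^ 2 = 6 * c ^ 2) : a = 0 := by
  have hc : c = 0 := by
    have ha := Rat.num_div_den a
    have hb := Rat.num_div_den b
    have hc := Rat.num_div_den c
    have da : (a.den : ℚ) ≠ 0 := by exact_mod_cast a.den_nz
    have db : (b.den : ℚ) ≠ 0 := by exact_mod_cast b.den_nz
    have dc : (c.den : ℚ) ≠ 0 := by exact_mod_cast c.den_nz
    rw [← ha, ← hb, ← hc] at h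
    field_simp at h
    have := pp6_int _ (a.num * b.den * c.den) (b.num * a.den * c.den) (c.num * a.den * b.den)
      le_rfl (by
        have h' : ((a.num : ℚ) * b.den * c.den) ^ 2 + (b.num * a.den * c.den) ^ 2
          = 6 * (c.num * a.den * b.den) ^ 2 := by linarith
        exact_mod_cast h')
    have hn : c.num = 0 := by
      simpa using this
    exact Rat.num_eq_zero.1 hn
  subst hc
  nlinarith [sq_nonneg a, sq_nonneg b]

/-- Quaternion multiplication by `2 + i + j`. -/
def pp6Y (i : Fin 11 × Fin 4) : (Fin 11 × Fin 4 → ℚ) →ₗ[ℚ] ℚ :=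
  let X : Fin 4 → (Fin 11 × Fin 4 → ℚ) →ₗ[ℚ] ℚ := fun k => LinearMap.proj (i.1, k)
  ![(2 : ℚ) • X 0 - X 1 - X 2, (2 : ℚ) • X 1 + X 0 + X 3, (2 : ℚ) • X 2 + X 0 - X 3,
    (2 : ℚ) • X 3 + X 2 - X 1] i.2

theorem pp6Y_sum (x : Fin 11 × Fin 4 → ℚ) :
    ∑ i, pp6Y i x ^ 2 = 6 * ∑ i, x i ^ 2 := by
  rw [Fintype.sum_prod_type, Fintype.sum_prod_type, Finset.mul_sum]
  refine Finset.sum_congr rfl fun a _ => ?_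
  simp [Fin.sum_univ_four, pp6Y]
  ring

/-- **There is no projective plane of order 6**: there are no point type `P` and line
type `L` with a membership relation forming a projective plane (any two distinct points
on a unique line, any two distinct lines meeting in a unique point, containing a
quadrangle) in which some line contains exactly 7 points. -/
theorem no_projective_plane_order_6 :
    ¬ ∃ (P L : Type) (_ : Membership P L) (_ : Configuration.ProjectivePlane P L),
      ∃ l : L, Configuration.pointCount P l = 7 := by
  classical
  rintro ⟨P, L, _, _, l, hl⟩
  have : Finite {p : P // p ∈ l} := Nat.finite_of_card_ne_zero (by
    change pointCount P l ≠ 0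
    omega)
  obtain ⟨hP, hL⟩ := pp6_finite (P := P) l
  have := Fintype.ofFinite P
  have := Fintype.ofFinite L
  have ho : ProjectivePlane.order P L = 6 := by
    have := ProjectivePlane.pointCount_eq P l
    omega
  have hcP : Fintype.card P = 43 := by
    rw [ProjectivePlane.card_points P L, ho]; norm_num
  have hcL : Fintype.card L = 43 := by
    rw [ProjectivePlane.card_lines P L, ho]; norm_num
  have hid := pp6_identity (P := P) (L := L) 6
    (fun p => by rw [ProjectivePlane.lineCount_eq, ho])
  have eP : Option P ≃ Fin 11 × Fin 4 := Fintype.equivOfCardEq (by simp [hcP])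
  have eL : Option L ≃ Fin 11 × Fin 4 := Fintype.equivOfCardEq (by simp [hcL])
  let F : L → (Fin 11 × Fin 4 → ℚ) →ₗ[ℚ] ℚ := fun m =>
    ∑ p : P, if p ∈ m then LinearMap.proj (eP (some p)) else 0
  have hF : ∀ m x, F m x = ∑ p : P, if p ∈ m then x (eP (some p)) else 0 := by
    intro m x
    simp only [F, LinearMap.sum_apply]
    refine Finset.sum_congr rfl fun p _ => ?_
    split_ifs <;> simp
  let f : Fin 11 × Fin 4 → (Fin 11 × Fin 4 → ℚ) →ₗ[ℚ] ℚ := fun i =>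
    (eL.symm i).elim 0 F
  obtain ⟨W, hd, hsq, hk⟩ := pp6_signs f pp6Y (by
    intro v hv
    have h := pp6Y_sum v
    simp only [hv] at h
    have h0 : ∑ i, v i ^ 2 = 0 := by
      have : (∑ i : Fin 11 × Fin 4, (0 : ℚ) ^ 2) = 0 := by simp
      linarith
    rw [Finset.sum_eq_zero_iff_of_nonneg (fun i _ => sq_nonneg _)] at h0
    funext i
    exact pow_eq_zero_iff (two_ne_zero) |>.1 (h0 i (Finset.mem_univ i)))
    (Finset.univ.erase (eL none))
  have hW : 0 < Module.finrank ℚ W := by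
    rw [Finset.card_erase_of_mem (Finset.mem_univ _), Finset.card_univ,
      Module.finrank_fintype_fun_eq_card, Fintype.card_prod, Fintype.card_fin,
      Fintype.card_fin] at hd
    omega
  obtain ⟨⟨v, hv⟩, hv0⟩ := Module.finrank_pos_iff_exists_ne_zero.1 hW
  have hv0' : v ≠ 0 := fun h => hv0 (Subtype.ext h)
  have hy : pp6Y (eL none) v ≠ 0 := by
    intro h
    refine hv0' (hk v hv fun i hi => ?_)
    have : i = eL none := by simpa using hi
    rw [this, h]
  have h1 := hid fun p => v (eP (some p))
  have h2 := pp6Y_sum v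
  rw [← Equiv.sum_comp eL, ← Equiv.sum_comp eP, Fintype.sum_option, Fintype.sum_option] at h2
  have h3 : ∑ m : L, pp6Y (eL (some m)) v ^ 2
      = ∑ m : L, (∑ p : P, if p ∈ m then v (eP (some p)) else 0) ^ 2 := by
    refine Finset.sum_congr rfl fun m _ => ?_
    rw [← hF, ← hsq v hv (eL (some m)) (by simp)]
    simp [f]
  rw [h3, h1] at h2
  push_cast at h2
  exact hy (pp6_rat _ (∑ p, v (eP (some p))) (v (eP none)) (by linarith))
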